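/- Path coupling: let (X, d) be a finite metric space of states where d takes values in 2ℕ, and suppose for every adjacent pair (x,x̃) with d(x,x̃) = 2 there is a coupling of P(x,·), P(x̃,·) under which E[d(x',x̃')] ≤ (1-c)·2. Suppose furthermore any pair at distance D can be connected by a path of D/2 adjacent pairs. Then for every pair (x,x̃) there exists a coupling of P(x,·) and P(x̃,·) with E[d(x',x̃')] ≤ (1-c) d(x,x̃). -/

import Mathlib

open Finset

/-- `γ` is a coupling of the probability vectors `P x ·` and `P x̃ ·`. -/
def IsCoupling {X : Type*} [Fintype X] (P : X → X → ℝ) (x x' : X)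
    (γ : X → X → ℝ) : Prop :=
  (∀ y y', 0 ≤ γ y y') ∧ (∀ y, (∑ y' : X, γ y y') = P x y)
    ∧ (∀ y', (∑ y : X, γ y y') = P x' y')

/-- Gluing of two couplings along their common marginal. -/
theorem glue_coupling {X : Type*} [Fintype X] (P : X → X → ℝ) (d : X → X → ℕ)
    (htri : ∀ x y z, d x z ≤ d x y + d y z) (x y z : X) (g h : X → X → ℝ)
    (hg : IsCoupling P x y g) (hh : IsCoupling P y z h) :
    ∃ γ : X → X → ℝ, IsCoupling P x z γ ∧
      (∑ a : X, ∑ b : X, γ a b * (d a b : ℝ)) ≤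
        (∑ a : X, ∑ b : X, g a b * (d a b : ℝ)) + ∑ a : X, ∑ b : X, h a b * (d a b : ℝ) := by
  obtain ⟨g0, g1, g2⟩ := hg
  obtain ⟨h0, h1, h2⟩ := hh
  have p0 : ∀ m, 0 ≤ P y m := fun m => by
    rw [← h1 m]; exact Finset.sum_nonneg fun b _ => h0 m b
  have gz : ∀ a m, P y m = 0 → g a m = 0 := fun a m hm => by
    rw [← g2 m, Finset.sum_eq_zero_iff_of_nonneg (fun b _ => g0 b m)] at hm
    exact hm a (Finset.mem_univ a)
  have hz : ∀ m b, P y m = 0 → h m b = 0 := fun m b hm => by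
    rw [← h1 m, Finset.sum_eq_zero_iff_of_nonneg (fun b _ => h0 m b)] at hm
    exact hm b (Finset.mem_univ b)
  have sb : ∀ a m, ∑ b : X, g a m * h m b / P y m = g a m := fun a m => by
    rw [← Finset.sum_div, ← Finset.mul_sum, h1 m]
    by_cases hm : P y m = 0
    · rw [gz a m hm]; simp
    · field_simp
  have sa : ∀ m b, ∑ a : X, g a m * h m b / P y m = h m b := fun m b => by
    rw [← Finset.sum_div, ← Finset.sum_mul, g2 m]
    by_cases hm : P y m = 0
    · rw [hz m b hm]; simp
    · field_simp
  have w0 : ∀ a m b, 0 ≤ g a m * h m b / P y m := fun a m b =>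
    div_nonneg (mul_nonneg (g0 a m) (h0 m b)) (p0 m)
  refine ⟨fun a b => ∑ m : X, g a m * h m b / P y m, ⟨?_, ?_, ?_⟩, ?_⟩
  · exact fun a b => Finset.sum_nonneg fun m _ => w0 a m b
  · intro a
    rw [Finset.sum_comm, ← g1 a]
    exact Finset.sum_congr rfl fun m _ => sb a m
  · intro b
    rw [Finset.sum_comm, ← h2 b]
    exact Finset.sum_congr rfl fun m _ => sa m b
  · have e1 : (∑ a : X, ∑ m : X, g a m * (d a m : ℝ)) =
        ∑ a : X, ∑ b : X, ∑ m : X, g a m * h m b / P y m * (d a m : ℝ) := by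
      refine Finset.sum_congr rfl fun a _ => ?_
      rw [Finset.sum_comm]
      refine Finset.sum_congr rfl fun m _ => ?_
      rw [← Finset.sum_mul, sb a m]
    have e2 : (∑ m : X, ∑ b : X, h m b * (d m b : ℝ)) =
        ∑ a : X, ∑ b : X, ∑ m : X, g a m * h m b / P y m * (d m b : ℝ) := by
      rw [Finset.sum_comm]
      rw [Finset.sum_comm (f := fun a b => ∑ m : X, g a m * h m b / P y m * (d m b : ℝ))]
      refine Finset.sum_congr rfl fun b _ => ?_
      rw [Finset.sum_comm]
      refine Finset.sum_congr rfl fun m _ => ?_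
      rw [← Finset.sum_mul, sa m b]
    rw [e1, e2, ← Finset.sum_add_distrib]
    refine Finset.sum_le_sum fun a _ => ?_
    rw [← Finset.sum_add_distrib]
    refine Finset.sum_le_sum fun b _ => ?_
    rw [← Finset.sum_add_distrib, Finset.sum_mul]
    refine Finset.sum_le_sum fun m _ => ?_
    rw [← mul_add]
    exact mul_le_mul_of_nonneg_left (by exact_mod_cast htri a m b) (w0 a m b)

/-- Path coupling: if every adjacent pair (at distance `2`) admits a coupling
contracting in expectation by a factor `1-c`, and any pair at distance `D` is
connected by a path of `D/2` adjacent pairs, then every pair admits a coupling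
contracting in expectation by the same factor. -/
theorem path_coupling
    {X : Type*} [Fintype X] (P : X → X → ℝ)
    (hP : ∀ x, (∀ y, 0 ≤ P x y) ∧ (∑ y : X, P x y) = 1)
    (d : X → X → ℕ)
    (hzero : ∀ x y, d x y = 0 ↔ x = y)
    (hsymm : ∀ x y, d x y = d y x)
    (htri : ∀ x y z, d x z ≤ d x y + d y z)
    (heven : ∀ x y, Even (d x y))
    (c : ℝ) (hc0 : 0 < c) (hc1 : c < 1)
    (hadj : ∀ x x' : X, d x x' = 2 → ∃ γ : X → X → ℝ, IsCoupling P x x' γ ∧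
      (∑ y : X, ∑ y' : X, γ y y' * (d y y' : ℝ)) ≤ (1 - c) * 2)
    (hpath : ∀ x x' : X, ∃ z : ℕ → X, z 0 = x ∧ z (d x x' / 2) = x'
      ∧ ∀ ℓ < d x x' / 2, d (z ℓ) (z (ℓ + 1)) = 2) :
    ∀ x x' : X, ∃ γ : X → X → ℝ, IsCoupling P x x' γ ∧
      (∑ y : X, ∑ y' : X, γ y y' * (d y y' : ℝ)) ≤ (1 - c) * (d x x' : ℝ) := by
  classical
  have key : ∀ (z : ℕ → X) (n : ℕ), (∀ l < n, d (z l) (z (l + 1)) = 2) →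
      ∃ γ : X → X → ℝ, IsCoupling P (z 0) (z n) γ ∧
        (∑ y : X, ∑ y' : X, γ y y' * (d y y' : ℝ)) ≤ (1 - c) * (2 * (n : ℝ)) := by
    intro z n
    induction n with
    | zero =>
      intro _
      refine ⟨fun a b => if a = b then P (z 0) a else 0, ⟨?_, ?_, ?_⟩, ?_⟩
      · intro a b
        dsimp only
        split_ifs
        · exact (hP (z 0)).1 a
        · exact le_rfl
      · intro a; simp
      · intro b; simp
      · have hd : ∀ a, d a a = 0 := fun a => (hzero a a).2 rfl
        simp [ite_mul, hd]
    | succ n ih =>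
      intro hl
      obtain ⟨g, hg, hgc⟩ := ih fun l h => hl l (by omega)
      obtain ⟨h, hh, hhc⟩ := hadj _ _ (hl n (by omega))
      obtain ⟨γ, hγ, hγc⟩ := glue_coupling P d htri _ _ _ g h hg hh
      refine ⟨γ, hγ, ?_⟩
      push_cast
      linarith
  intro x x'
  obtain ⟨z, h0, hn, hl⟩ := hpath x x'
  obtain ⟨γ, hγ, hγc⟩ := key z _ hl
  rw [h0, hn] at hγ
  refine ⟨γ, hγ, ?_⟩
  have h2 : 2 * (d x x' / 2) = d x x' := Nat.two_mul_div_two_of_even (heven x x')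
  have h3 : (2 : ℝ) * ((d x x' / 2 : ℕ) : ℝ) = (d x x' : ℝ) := by exact_mod_cast h2
  rw [h3] at hγc
  exact hγc
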